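/- For n ≥ 1, the number of Fishburn permutations of length n avoiding the classical patterns 321, 3124, and 4123 equals F_{n+1} − 1, where F_n is the n-th Fibonacci number with F_0 = F_1 = 1. -/

import Mathlib

/-- A permutation `π` of `Fin n` contains the classical pattern `p` (given as a
function `Fin k → ℕ` listing the pattern's entries). -/
def Contains {n k : ℕ} (π : Equiv.Perm (Fin n)) (p : Fin k → ℕ) : Prop :=
  ∃ f : Fin k → Fin n, StrictMono f ∧ ∀ i j, p i < p j ↔ π (f i) < π (f j)

/-- Classical pattern avoidance. -/
def Avoids {n k : ℕ} (π : Equiv.Perm (Fin n)) (p : Fin k → ℕ) : Prop :=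
  ¬ Contains π p

/-- A permutation is Fishburn if there are no indices `i < j` with
`π i, π (i+1), π j` forming a 231 pattern and `π i = π j + 1`. -/
def IsFishburn {n : ℕ} (π : Equiv.Perm (Fin n)) : Prop :=
  ¬ ∃ (i j : ℕ) (hij : i + 1 < j) (hj : j < n),
      π ⟨i, by omega⟩ < π ⟨i + 1, by omega⟩ ∧
      π ⟨j, hj⟩ < π ⟨i, by omega⟩ ∧
      (π ⟨i, by omega⟩ : ℕ) = (π ⟨j, hj⟩ : ℕ) + 1

theorem contains_321_iff {n : ℕ} (π : Equiv.Perm (Fin n)) :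
    Contains π ![3, 2, 1] ↔ ∃ a b c, a < b ∧ b < c ∧ π c < π b ∧ π b < π a := by
  constructor
  · rintro ⟨f, hf, h⟩
    exact ⟨f 0, f 1, f 2, hf (by decide), hf (by decide), (h 2 1).1 (by decide),
      (h 1 0).1 (by decide)⟩
  · rintro ⟨a, b, c, hab, hbc, h₁, h₂⟩
    refine ⟨![a, b, c], ?_, ?_⟩
    · rw [Fin.strictMono_iff_lt_succ]
      simp [Fin.forall_fin_succ, hab, hbc]
    · simp [Fin.forall_fin_succ]
      grind

theorem contains_3124_iff {n : ℕ} (π : Equiv.Perm (Fin n)) :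
    Contains π ![3, 1, 2, 4] ↔ ∃ a b c d, a < b ∧ b < c ∧ c < d ∧
      π b < π c ∧ π c < π a ∧ π a < π d := by
  constructor
  · rintro ⟨f, hf, h⟩
    exact ⟨f 0, f 1, f 2, f 3, hf (by decide), hf (by decide), hf (by decide),
      (h 1 2).1 (by decide), (h 2 0).1 (by decide), (h 0 3).1 (by decide)⟩
  · rintro ⟨a, b, c, d, hab, hbc, hcd, h₁, h₂, h₃⟩
    refine ⟨![a, b, c, d], ?_, ?_⟩
    · rw [Fin.strictMono_iff_lt_succ]
      simp [Fin.forall_fin_succ, hab, hbc, hcd]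
    · simp [Fin.forall_fin_succ]
      grind

theorem contains_4123_iff {n : ℕ} (π : Equiv.Perm (Fin n)) :
    Contains π ![4, 1, 2, 3] ↔ ∃ a b c d, a < b ∧ b < c ∧ c < d ∧
      π b < π c ∧ π c < π d ∧ π d < π a := by
  constructor
  · rintro ⟨f, hf, h⟩
    exact ⟨f 0, f 1, f 2, f 3, hf (by decide), hf (by decide), hf (by decide),
      (h 1 2).1 (by decide), (h 2 3).1 (by decide), (h 3 0).1 (by decide)⟩
  · rintro ⟨a, b, c, d, hab, hbc, hcd, h₁, h₂, h₃⟩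
    refine ⟨![a, b, c, d], ?_, ?_⟩
    · rw [Fin.strictMono_iff_lt_succ]
      simp [Fin.forall_fin_succ, hab, hbc, hcd]
    · simp [Fin.forall_fin_succ]
      grind

theorem isFishburn_iff {n : ℕ} (π : Equiv.Perm (Fin n)) :
    IsFishburn π ↔ ∀ a b c : Fin n, (b : ℕ) = a + 1 → b < c → π a < π b →
      (π a : ℕ) ≠ π c + 1 := by
  constructor
  · rintro h ⟨a, ha⟩ ⟨b, hb⟩ ⟨c, hc⟩ rfl hbc h₁ h₂
    exact h ⟨a, c, hbc, hc, h₁, by rw [Fin.lt_def]; omega, h₂⟩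
  · rintro h ⟨i, j, hij, hj, h₁, -, h₃⟩
    exact h _ _ ⟨j, hj⟩ rfl hij h₁ h₃

/-- The Fishburn permutations avoiding `321`, `3124` and `4123`. -/
def fishburnClass (n : ℕ) : Set (Equiv.Perm (Fin n)) :=
  {π | IsFishburn π ∧ Avoids π ![3, 2, 1] ∧ Avoids π ![3, 1, 2, 4] ∧ Avoids π ![4, 1, 2, 3]}

theorem mem_fishburnClass_iff {n : ℕ} (π : Equiv.Perm (Fin n)) :
    π ∈ fishburnClass n ↔
      (∀ a b c : Fin n, (b : ℕ) = a + 1 → b < c → π a < π b → (π a : ℕ) ≠ π c + 1) ∧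
      (∀ a b c, a < b → b < c → π c < π b → ¬ π b < π a) ∧
      (∀ a b c d, a < b → b < c → c < d → π b < π c → π c < π a → ¬ π a < π d) ∧
      (∀ a b c d, a < b → b < c → c < d → π b < π c → π c < π d → ¬ π d < π a) := by
  simp only [fishburnClass, Set.mem_ofPred_eq, Avoids, isFishburn_iff, contains_321_iff,
    contains_3124_iff, contains_4123_iff]
  push Not
  rfl

/-- The direct sum `1 ⊕ π`. -/
def oneSum {n : ℕ} (π : Equiv.Perm (Fin n)) : Equiv.Perm (Fin (n + 1)) :=
  Equiv.Perm.decomposeFin.symm (0, π)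

/-- The direct sum `21 ⊕ π`. -/
def swapSum {n : ℕ} (π : Equiv.Perm (Fin n)) : Equiv.Perm (Fin (n + 2)) :=
  Equiv.Perm.decomposeFin.symm (1, oneSum π)

section DirectSum

variable {n : ℕ} (π : Equiv.Perm (Fin n))

@[simp] theorem oneSum_zero : oneSum π 0 = 0 := by simp [oneSum]

@[simp] theorem oneSum_succ (i : Fin n) : oneSum π i.succ = (π i).succ := by
  simp [oneSum]

@[simp] theorem swapSum_zero : swapSum π 0 = 1 := by simp [swapSum]

@[simp] theorem swapSum_one : swapSum π 1 = 0 := by simp [swapSum]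

@[simp] theorem swapSum_succ_succ (i : Fin n) : swapSum π i.succ.succ = (π i).succ.succ := by
  rw [swapSum, Equiv.Perm.decomposeFin_symm_apply_succ, oneSum_succ,
    Equiv.swap_apply_of_ne_of_ne (Fin.succ_ne_zero _)]
  simp [Fin.ext_iff]

theorem oneSum_injective : Function.Injective (oneSum (n := n)) := fun π σ h => by
  simpa only [oneSum, EmbeddingLike.apply_eq_iff_eq, Prod.mk.injEq, true_and] using h

theorem swapSum_injective : Function.Injective (swapSum (n := n)) := fun π σ h =>
  oneSum_injective (by simpa [swapSum] using h)

theorem exists_oneSum_eq {π : Equiv.Perm (Fin (n + 1))} (h : π 0 = 0) :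
    ∃ σ, oneSum σ = π := by
  obtain ⟨⟨p, σ⟩, rfl⟩ := Equiv.Perm.decomposeFin.symm.surjective π
  obtain rfl : p = 0 := by simpa using h
  exact ⟨σ, rfl⟩

theorem exists_swapSum_eq {π : Equiv.Perm (Fin (n + 2))} (h₀ : π 0 = 1) (h₁ : π 1 = 0) :
    ∃ σ, swapSum σ = π := by
  obtain ⟨⟨p, τ⟩, rfl⟩ := Equiv.Perm.decomposeFin.symm.surjective π
  obtain rfl : p = 1 := by simpa using h₀
  have h := Equiv.Perm.decomposeFin_symm_apply_succ τ 1 0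
  rw [Fin.succ_zero_eq_one, h₁, eq_comm, Equiv.swap_apply_eq_iff, Equiv.swap_apply_left,
    ← Fin.succ_zero_eq_one, Fin.succ_inj] at h
  obtain ⟨σ, rfl⟩ := exists_oneSum_eq h
  exact ⟨σ, rfl⟩

theorem oneSum_mem_iff : oneSum π ∈ fishburnClass (n + 1) ↔ π ∈ fishburnClass n := by
  simp only [mem_fishburnClass_iff]
  refine ⟨fun ⟨h₁, h₂, h₃, h₄⟩ => ⟨fun a b c => ?_, fun a b c => ?_, fun a b c d => ?_,
    fun a b c d => ?_⟩, fun ⟨h₁, h₂, h₃, h₄⟩ => ⟨fun a b c => ?_, fun a b c => ?_,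
    fun a b c d => ?_, fun a b c d => ?_⟩⟩
  · simpa using h₁ a.succ b.succ c.succ
  · simpa using h₂ a.succ b.succ c.succ
  · simpa using h₃ a.succ b.succ c.succ d.succ
  · simpa using h₄ a.succ b.succ c.succ d.succ
  · cases a using Fin.cases <;> cases b using Fin.cases <;> cases c using Fin.cases <;> simp
    simpa using h₁ _ _ _
  · cases a using Fin.cases <;> cases b using Fin.cases <;> cases c using Fin.cases <;> simp
    simpa using h₂ _ _ _
  · cases a using Fin.cases <;> cases b using Fin.cases <;> cases c using Fin.cases <;>
      cases d using Fin.cases <;> simp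
    simpa using h₃ _ _ _ _
  · cases a using Fin.cases <;> cases b using Fin.cases <;> cases c using Fin.cases <;>
      cases d using Fin.cases <;> simp
    simpa using h₄ _ _ _ _

theorem swapSum_cases (x : Fin (n + 2)) :
    ((x : ℕ) = 0 ∧ (swapSum π x : ℕ) = 1) ∨ ((x : ℕ) = 1 ∧ (swapSum π x : ℕ) = 0) ∨
      ∃ y : Fin n, (x : ℕ) = y + 2 ∧ (swapSum π x : ℕ) = π y + 2 := by
  cases x using Fin.cases with
  | zero => simp
  | succ x =>
    cases x using Fin.cases with
    | zero => simp
    | succ x => exact .inr (.inr ⟨x, by simp⟩)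

theorem swapSum_mem_iff : swapSum π ∈ fishburnClass (n + 2) ↔ π ∈ fishburnClass n := by
  simp only [mem_fishburnClass_iff]
  refine ⟨fun ⟨h₁, h₂, h₃, h₄⟩ => ⟨fun a b c => ?_, fun a b c => ?_, fun a b c d => ?_,
    fun a b c d => ?_⟩, fun ⟨h₁, h₂, h₃, h₄⟩ => ⟨fun a b c => ?_, fun a b c => ?_,
    fun a b c d => ?_, fun a b c d => ?_⟩⟩
  · simpa using h₁ a.succ.succ b.succ.succ c.succ.succ
  · simpa using h₂ a.succ.succ b.succ.succ c.succ.succ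
  · simpa using h₃ a.succ.succ b.succ.succ c.succ.succ d.succ.succ
  · simpa using h₄ a.succ.succ b.succ.succ c.succ.succ d.succ.succ
  all_goals simp only [Fin.lt_def] at *
  · rcases swapSum_cases π a with ha | ha | ⟨a', ha⟩ <;>
    rcases swapSum_cases π b with hb | hb | ⟨b', hb⟩ <;>
    rcases swapSum_cases π c with hc | hc | ⟨c', hc⟩ <;>
    try omega
    have := h₁ a' b' c'
    omega
  · rcases swapSum_cases π a with ha | ha | ⟨a', ha⟩ <;>
    rcases swapSum_cases π b with hb | hb | ⟨b', hb⟩ <;>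
    rcases swapSum_cases π c with hc | hc | ⟨c', hc⟩ <;>
    try omega
    have := h₂ a' b' c'
    omega
  · rcases swapSum_cases π a with ha | ha | ⟨a', ha⟩ <;>
    rcases swapSum_cases π b with hb | hb | ⟨b', hb⟩ <;>
    rcases swapSum_cases π c with hc | hc | ⟨c', hc⟩ <;>
    rcases swapSum_cases π d with hd | hd | ⟨d', hd⟩ <;>
    try omega
    have := h₃ a' b' c' d'
    omega
  · rcases swapSum_cases π a with ha | ha | ⟨a', ha⟩ <;>
    rcases swapSum_cases π b with hb | hb | ⟨b', hb⟩ <;>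
    rcases swapSum_cases π c with hc | hc | ⟨c', hc⟩ <;>
    rcases swapSum_cases π d with hd | hd | ⟨d', hd⟩ <;>
    try omega
    have := h₄ a' b' c' d'
    omega

end DirectSum

/-- The entries of `3 1 4 5 ⋯ (n+3) 2`, with positions and values shifted to start from `0`. -/
def exceptionalFun (n i : ℕ) : ℕ :=
  if i = 0 then 2 else if i = 1 then 0 else if i = n + 2 then 1 else i + 1

theorem exceptionalFun_lt {n i : ℕ} (hi : i < n + 3) : exceptionalFun n i < n + 3 := by
  grind [exceptionalFun]

theorem exceptionalFun_injective (n : ℕ) : Function.Injective fun i : Fin (n + 3) =>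
    (⟨exceptionalFun n i, exceptionalFun_lt i.2⟩ : Fin (n + 3)) := by
  intro i j h
  simp only [Fin.mk.injEq, exceptionalFun] at h
  ext
  grind

/-- The permutation `3 1 4 5 ⋯ (n+3) 2`. -/
noncomputable def exceptionalPerm (n : ℕ) : Equiv.Perm (Fin (n + 3)) :=
  Equiv.ofBijective _ (Finite.injective_iff_bijective.1 (exceptionalFun_injective n))

theorem exceptionalPerm_val (n : ℕ) (i : Fin (n + 3)) :
    (exceptionalPerm n i : ℕ) = exceptionalFun n i :=
  rfl

theorem exceptionalPerm_mem (n : ℕ) : exceptionalPerm n ∈ fishburnClass (n + 3) := by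
  simp only [mem_fishburnClass_iff, Fin.lt_def, exceptionalPerm_val, exceptionalFun]
  refine ⟨?_, ?_, ?_, ?_⟩
  · intro a b c; grind
  · intro a b c; grind
  · intro a b c d; grind
  · intro a b c d; grind

theorem val_apply_eq_iff {n : ℕ} (π : Equiv.Perm (Fin n)) (i j : Fin n) :
    (π i : ℕ) = π j ↔ (i : ℕ) = j := by
  rw [← Fin.ext_iff, ← Fin.ext_iff, π.apply_eq_iff_eq]

theorem val_apply_zero_le_two {n : ℕ} {π : Equiv.Perm (Fin (n + 3))}
    (hπ : π ∈ fishburnClass (n + 3)) : (π 0 : ℕ) ≤ 2 := by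
  obtain ⟨-, h₂, -, h₄⟩ := (mem_fishburnClass_iff π).1 hπ
  by_contra! h
  obtain ⟨a, ha⟩ := π.surjective ⟨0, by omega⟩
  obtain ⟨b, hb⟩ := π.surjective ⟨1, by omega⟩
  obtain ⟨c, hc⟩ := π.surjective ⟨2, by omega⟩
  have := h₂ 0 b a
  have := h₂ 0 c b
  have := h₄ 0 a b c
  have := val_apply_eq_iff π 0 a
  have := val_apply_eq_iff π 0 b
  have := val_apply_eq_iff π 0 c
  have := val_apply_eq_iff π b a
  have := val_apply_eq_iff π c b
  simp only [Fin.ext_iff, Fin.lt_def, Fin.val_zero] at *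
  omega

theorem eq_exceptionalPerm {n : ℕ} {π : Equiv.Perm (Fin (n + 3))}
    (hπ : π ∈ fishburnClass (n + 3)) (h₀ : π 0 ≠ 0) (h₁ : ¬ (π 0 = 1 ∧ π 1 = 0)) :
    π = exceptionalPerm n := by
  have hle := val_apply_zero_le_two hπ
  obtain ⟨hF, h321, h3124, -⟩ := (mem_fishburnClass_iff π).1 hπ
  have hinj := val_apply_eq_iff π
  obtain ⟨a, ha⟩ := π.surjective ⟨0, by omega⟩
  obtain ⟨b, hb⟩ := π.surjective ⟨1, by omega⟩
  simp only [ne_eq, Fin.ext_iff (b := 0), Fin.ext_iff (b := 1), Fin.ext_iff (b := ⟨_, _⟩),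
    Fin.lt_def, Fin.val_zero, Fin.val_one] at *
  have hzero : (π 0 : ℕ) = 2 := by
    have := hF 0 1 a
    have := hinj 0 a
    have := hinj 0 1
    have := hinj a 1
    simp only [Fin.val_zero, Fin.val_one, zero_add, true_imp_iff] at *
    omega
  have hab : (a : ℕ) < b := by
    have := h321 0 b a
    have := hinj 0 b
    have := hinj a b
    have := hinj 0 a
    simp only [Fin.val_zero] at *
    omega
  have hlast : (b : ℕ) = n + 2 := by
    have := h3124 0 a b (Fin.last _)
    have := hinj 0 a
    have := hinj a (Fin.last _)
    have := hinj b (Fin.last _)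
    have := hinj 0 (Fin.last _)
    simp only [Fin.val_zero, Fin.val_last] at *
    omega
  have hone : (π 1 : ℕ) = 0 := by
    have := hF 0 1 b
    have := hinj 0 b
    have := hinj 0 a
    have := hinj 0 1
    have := hinj b 1
    have := hinj a 1
    simp only [Fin.val_zero, Fin.val_one, zero_add, true_imp_iff] at *
    omega
  have hmono (i j : Fin (n + 3)) (hi : 1 < (i : ℕ)) (hij : (i : ℕ) < j)
      (hj : (j : ℕ) < n + 2) : (π i : ℕ) < π j := by
    have := h321 i j b
    have := hinj i j
    have := hinj b j
    have := hinj a j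
    have := hinj 1 j
    simp only [Fin.val_one] at *
    omega
  have hlower (k : ℕ) (hk : k + 2 < n + 2) : k + 3 ≤ (π ⟨k + 2, by omega⟩ : ℕ) := by
    induction k with
    | zero =>
      have := hinj 0 ⟨2, by omega⟩
      have := hinj 1 ⟨2, by omega⟩
      have := hinj b ⟨2, by omega⟩
      simp only [Fin.val_zero, Fin.val_one, zero_add] at *
      omega
    | succ k ih =>
      have := ih (by omega)
      have := hmono ⟨k + 2, by omega⟩ ⟨k + 1 + 2, by omega⟩ (by simp) (by simp) hk
      omega
  have hupper (k : ℕ) (hk : k + 2 ≤ n + 1) : (π ⟨n + 1 - k, by omega⟩ : ℕ) + k ≤ n + 2 := by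
    induction k with
    | zero => omega
    | succ k ih =>
      have := ih (by omega)
      have := hmono ⟨n + 1 - (k + 1), by omega⟩ ⟨n + 1 - k, by omega⟩ (by simp; omega)
        (by simp; omega) (by simp; omega)
      omega
  ext i
  rw [exceptionalPerm_val, exceptionalFun]
  split_ifs with hi₀ hi₁ hi₂
  · rwa [show i = 0 from Fin.ext hi₀]
  · rwa [show i = 1 from Fin.ext hi₁]
  · rwa [show i = b from Fin.ext (hi₂.trans hlast.symm)]
  · have hi := i.2
    have hl := hlower (i - 2) (by omega)
    have hu := hupper (n + 1 - i) (by omega)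
    simp only [show (i : ℕ) - 2 + 2 = i by omega, show n + 1 - (n + 1 - (i : ℕ)) = i by omega,
      Fin.eta] at hl hu
    omega

theorem fishburnClass_two : fishburnClass 2 = Set.univ := by
  ext π
  simp only [mem_fishburnClass_iff, Set.mem_univ, iff_true, Fin.lt_def]
  refine ⟨?_, ?_, ?_, ?_⟩ <;> intros <;> omega

theorem fishburnClass_one : fishburnClass 1 = Set.univ := by
  ext π
  simp only [mem_fishburnClass_iff, Set.mem_univ, iff_true, Fin.lt_def]
  refine ⟨?_, ?_, ?_, ?_⟩ <;> intros <;> omega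

theorem fishburnClass_add_three (n : ℕ) : fishburnClass (n + 3) =
    oneSum '' fishburnClass (n + 2) ∪ swapSum '' fishburnClass (n + 1) ∪
      {exceptionalPerm n} := by
  ext π
  constructor
  · intro hπ
    by_cases h₀ : π 0 = 0
    · obtain ⟨σ, rfl⟩ := exists_oneSum_eq h₀
      exact .inl (.inl ⟨σ, (oneSum_mem_iff σ).1 hπ, rfl⟩)
    by_cases h₁ : π 0 = 1 ∧ π 1 = 0
    · obtain ⟨σ, rfl⟩ := exists_swapSum_eq h₁.1 h₁.2
      exact .inl (.inr ⟨σ, (swapSum_mem_iff σ).1 hπ, rfl⟩)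
    · exact .inr (eq_exceptionalPerm hπ h₀ h₁)
  · rintro ((⟨σ, hσ, rfl⟩ | ⟨σ, hσ, rfl⟩) | rfl)
    · exact (oneSum_mem_iff σ).2 hσ
    · exact (swapSum_mem_iff σ).2 hσ
    · exact exceptionalPerm_mem n

theorem ncard_fishburnClass_add_three (n : ℕ) : (fishburnClass (n + 3)).ncard =
    (fishburnClass (n + 2)).ncard + (fishburnClass (n + 1)).ncard + 1 := by
  rw [fishburnClass_add_three, Set.ncard_union_eq, Set.ncard_union_eq,
    Set.ncard_image_of_injective _ oneSum_injective,
    Set.ncard_image_of_injective _ swapSum_injective, Set.ncard_singleton]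
  · rw [Set.disjoint_left]
    rintro _ ⟨σ, -, rfl⟩ ⟨τ, -, h⟩
    simpa using congrArg (· 0) h
  · rw [Set.disjoint_singleton_right]
    have h := exceptionalPerm_val n 0
    rintro (⟨σ, -, hs⟩ | ⟨σ, -, hs⟩) <;> simp [← hs, exceptionalFun] at h

theorem ncard_fishburnClass (n : ℕ) : (fishburnClass (n + 1)).ncard + 1 = Nat.fib (n + 3) := by
  induction n using Nat.twoStepInduction with
  | zero => simp [fishburnClass_one, Set.ncard_univ, Nat.fib_add_two]
  | one => simp [fishburnClass_two, Set.ncard_univ, Nat.fib_add_two, Fintype.card_perm]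
  | more n h₁ h₂ =>
    have h : Nat.fib (n + 5) = Nat.fib (n + 3) + Nat.fib (n + 4) := Nat.fib_add_two
    replace h₂ : (fishburnClass (n + 2)).ncard + 1 = Nat.fib (n + 4) := h₂
    change (fishburnClass (n + 3)).ncard + 1 = Nat.fib (n + 5)
    rw [ncard_fishburnClass_add_three]
    omega

theorem fishburn_321_3124_4123 (n : ℕ) (hn : 1 ≤ n) :
    {π : Equiv.Perm (Fin n) | IsFishburn π ∧ Avoids π ![3, 2, 1] ∧ Avoids π ![3, 1, 2, 4] ∧ Avoids π ![4, 1, 2, 3]}.ncard = Nat.fib (n + 2) - 1 := by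
  obtain ⟨m, rfl⟩ := Nat.exists_eq_add_of_le' hn
  exact Nat.eq_sub_of_add_eq (ncard_fishburnClass m)
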